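/- Let a ∈ (0,1), g > 0, w > 0 and φ ∈ [0, π/2]. Then w · sup_{ψ ∈ [0, arccos a]} cos²(φ − ψ) ≤ g if and only if either w ≤ g, or ( g < w ≤ g/(1−a²) and cos²φ ≤ m(√(g/w)) ). -/

import Mathlib

open Real

/-- The function `m(t) = (a·t − √((1−a²)(1−t²)))²` from Theorem 1. -/
noncomputable def mFun (a t : ℝ) : ℝ :=
  (a * t - Real.sqrt ((1 - a ^ 2) * (1 - t ^ 2))) ^ 2

lemma mFun_eq_cos_sq_arccos_add {a t : ℝ} (ha : a ∈ Set.Icc (-1 : ℝ) 1)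
    (ht : t ∈ Set.Icc (-1 : ℝ) 1) :
    mFun a t = Real.cos (Real.arccos a + Real.arccos t) ^ 2 := by
  obtain ⟨ha₁, ha₂⟩ := ha
  have h : 0 ≤ 1 - a ^ 2 := by nlinarith
  rw [mFun, Real.cos_add, Real.cos_arccos ha₁ ha₂, Real.cos_arccos ht.1 ht.2,
    Real.sin_arccos, Real.sin_arccos, Real.sqrt_mul h]

/-- A bounded supremum of nonnegative reals lies below a nonnegative number iff each term does:
the value `0` taken by `⨆` outside the index set is harmless. -/
lemma ciSup_mem_le_iff_of_nonneg {ι : Type*} {s : Set ι} {f : ι → ℝ} {b c : ℝ}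
    (hf : ∀ i, 0 ≤ f i) (hb : ∀ i, f i ≤ b) (hc : 0 ≤ c) :
    (⨆ i ∈ s, f i) ≤ c ↔ ∀ i ∈ s, f i ≤ c := by
  refine ⟨fun h i hi => ?_, fun h => Real.iSup_le (fun i => Real.iSup_le (h i) hc) hc⟩
  have hbdd : BddAbove (Set.range fun i => ⨆ _ : i ∈ s, f i) := by
    refine ⟨b, ?_⟩
    rintro _ ⟨j, rfl⟩
    exact Real.iSup_le (fun _ => hb j) ((hf j).trans (hb j))
  have hle := le_ciSup hbdd i
  simp only [hi, ciSup_unique] at hle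
  exact hle.trans h

/-- On `[0, π/2]` the squared cosine is strictly decreasing. -/
lemma cos_sq_le_cos_sq_iff {x y : ℝ} (hx : x ∈ Set.Icc 0 (π / 2)) (hy : y ∈ Set.Icc 0 (π / 2)) :
    Real.cos x ^ 2 ≤ Real.cos y ^ 2 ↔ y ≤ x := by
  have hx' := Real.cos_nonneg_of_mem_Icc ⟨by linarith [hx.1, hy.1, Real.pi_pos], hx.2⟩
  have hy' := Real.cos_nonneg_of_mem_Icc ⟨by linarith [hx.1, hy.1, Real.pi_pos], hy.2⟩
  rw [pow_le_pow_iff_left₀ hx' hy' two_ne_zero]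
  exact Real.strictAntiOn_cos.le_iff_ge ⟨hx.1, by linarith [hx.2, Real.pi_pos]⟩
    ⟨hy.1, by linarith [hy.2, Real.pi_pos]⟩

/-- For `a ∈ (0,1)`, `g > 0`, `w > 0` and `φ ∈ [0, π/2]`,
`w · sup_{ψ ∈ [0, arccos a]} cos²(φ − ψ) ≤ g` iff either `w ≤ g`, or
(`g < w ≤ g/(1−a²)` and `cos²φ ≤ m(√(g/w))`). -/
theorem event_decomposition (a g w φ : ℝ) (ha : a ∈ Set.Ioo (0 : ℝ) 1)
    (hg : 0 < g) (hw : 0 < w) (hφ : φ ∈ Set.Icc (0 : ℝ) (π / 2)) :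
    w * (⨆ ψ ∈ Set.Icc (0 : ℝ) (Real.arccos a), Real.cos (φ - ψ) ^ 2) ≤ g ↔
      (w ≤ g ∨
        (g < w ∧ w ≤ g / (1 - a ^ 2) ∧
          Real.cos φ ^ 2 ≤ mFun a (Real.sqrt (g / w)))) := by
  obtain ⟨ha₀, ha₁⟩ := ha
  obtain ⟨hφ₀, hφ₁⟩ := hφ
  rw [mul_comm, ← le_div_iff₀ hw, ciSup_mem_le_iff_of_nonneg (fun _ => sq_nonneg _)
    (fun _ => Real.cos_sq_le_one _) (by positivity)]
  rcases le_or_gt w g with hwg | hwg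
  · exact iff_of_true
      (fun _ _ => (Real.cos_sq_le_one _).trans ((one_le_div hw).2 hwg)) (Or.inl hwg)
  have hr₀ : 0 ≤ g / w := by positivity
  have hr₁ : g / w < 1 := (div_lt_one hw).2 hwg
  set t := Real.sqrt (g / w)
  have ht₀ : 0 ≤ t := Real.sqrt_nonneg _
  have ht₁ : t ≤ 1 := Real.sqrt_le_one.2 hr₁.le
  have htsq : t ^ 2 = g / w := Real.sq_sqrt hr₀
  have hcosα : Real.cos (Real.arccos t) = t := Real.cos_arccos (by linarith) ht₁
  have hcosθ : Real.cos (Real.arccos a) = a := Real.cos_arccos (by linarith) ha₁.le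
  rw [mFun_eq_cos_sq_arccos_add ⟨by linarith, ha₁.le⟩ ⟨by linarith, ht₁⟩, ← htsq]
  have hα₀ := Real.arccos_nonneg t
  have hα₁ := Real.arccos_le_pi_div_two.2 ht₀
  have hθ₀ := Real.arccos_nonneg a
  have hθ₁ := Real.arccos_le_pi_div_two.2 ha₀.le
  set α := Real.arccos t
  set θ := Real.arccos a
  have hpos : 0 < 1 - a ^ 2 := by nlinarith
  have hrange : w ≤ g / (1 - a ^ 2) ↔ θ + α ≤ π / 2 := by
    rw [le_div_comm₀ hw hpos, ← htsq, ← hcosα, ← hcosθ, ← Real.sin_sq,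
      ← Real.cos_pi_div_two_sub, cos_sq_le_cos_sq_iff ⟨by linarith, by linarith⟩ ⟨hα₀, hα₁⟩]
    constructor <;> intro h <;> linarith
  have hsup : (∀ ψ ∈ Set.Icc 0 θ, Real.cos (φ - ψ) ^ 2 ≤ t ^ 2) ↔ θ + α ≤ φ := by
    rw [← hcosα]
    constructor
    · intro h
      have hθφ : θ ≤ φ := by
        by_contra! hlt
        have := h φ ⟨hφ₀, hlt.le⟩
        rw [sub_self, Real.cos_zero, hcosα, htsq] at this
        linarith
      have := (cos_sq_le_cos_sq_iff ⟨by linarith, by linarith⟩ ⟨hα₀, hα₁⟩).1 (h θ ⟨hθ₀, le_rfl⟩)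
      linarith
    · rintro h ψ ⟨hψ₀, hψ₁⟩
      exact (cos_sq_le_cos_sq_iff ⟨by linarith, by linarith⟩ ⟨hα₀, hα₁⟩).2 (by linarith)
  rw [hsup, hrange]
  constructor
  · intro h
    have hle : θ + α ≤ π / 2 := h.trans hφ₁
    exact Or.inr ⟨hwg, hle,
      (cos_sq_le_cos_sq_iff ⟨hφ₀, hφ₁⟩ ⟨by linarith, hle⟩).2 h⟩
  · rintro (h | ⟨-, hle, h⟩)
    · exact absurd h hwg.not_ge
    · exact (cos_sq_le_cos_sq_iff ⟨hφ₀, hφ₁⟩ ⟨by linarith, hle⟩).1 h
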